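/- arXiv:2206.12316 — 2 statements merged into one kernel-verified Lean document; each statement's English description precedes it below -/
import Mathlib

section
/- Let n ≥ 1, let u ∈ ℝⁿ with u_i ≥ 0 for all i, let Q ≥ 0, and let P = {q ∈ ℝⁿ : 0 ≤ q_i ≤ u_i for all i, and ∑_{i=1}^{n} q_i ≤ Q}. A point q ∈ P is an extreme point of P if and only if (i) at most one coordinate i satisfies 0 < q_i < u_i (i.e., q has at most one partial coordinate), and (ii) if such a coordinate exists, then ∑_{i=1}^{n} q_i = Q. -/
theorem eq_zero_of_mem_extremePoints_of_add_mem_of_sub_mem {E : Type*} [AddCommGroup E]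
    [Module ℝ E] {A : Set E} {x d : E} (hx : x ∈ Set.extremePoints ℝ A)
    (hadd : x + d ∈ A) (hsub : x - d ∈ A) : d = 0 := by
  have h : x ∈ openSegment ℝ (x + d) (x - d) :=
    ⟨1 / 2, 1 / 2, by norm_num, by norm_num, by norm_num, by module⟩
  simpa using hx.2 hadd hsub h

/-- In a proper convex combination of numbers at most `c` with value `c`, the first one is `c`. -/
theorem eq_of_convex_combination_eq_upper {a b x y c : ℝ} (ha : 0 < a) (hb : 0 < b)
    (hab : a + b = 1) (hx : x ≤ c) (hy : y ≤ c) (h : a * x + b * y = c) : x = c := by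
  obtain rfl : b = 1 - a := by linarith
  nlinarith [mul_nonneg hb.le (sub_nonneg.2 hy), mul_nonneg ha.le (sub_nonneg.2 hx)]


/-- Characterization of the extreme points of the polytope
`P = {q : 0 ≤ qᵢ ≤ uᵢ, ∑ᵢ qᵢ ≤ Q}`: a point `q ∈ P` is extreme iff it has at most
one partial coordinate (a coordinate `i` with `0 < qᵢ < uᵢ`) and, if such a
coordinate exists, `∑ᵢ qᵢ = Q`. -/
theorem extremePoint_iff_at_most_one_partial
    (n : ℕ) (hn : 1 ≤ n) (u : Fin n → ℝ) (hu : ∀ i, 0 ≤ u i) (Q : ℝ) (hQ : 0 ≤ Q)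
    (q : Fin n → ℝ)
    (hq : q ∈ {x : Fin n → ℝ | (∀ i, 0 ≤ x i ∧ x i ≤ u i) ∧ ∑ i, x i ≤ Q}) :
    q ∈ Set.extremePoints ℝ {x : Fin n → ℝ | (∀ i, 0 ≤ x i ∧ x i ≤ u i) ∧ ∑ i, x i ≤ Q} ↔
      ((∀ i j, (0 < q i ∧ q i < u i) → (0 < q j ∧ q j < u j) → i = j) ∧
        ((∃ i, 0 < q i ∧ q i < u i) → ∑ i, q i = Q)) := by
  obtain ⟨hqb, hqs⟩ := hq
  constructor
  · intro hext
    refine ⟨fun i j hi hj => ?_, fun ⟨i, hi⟩ => ?_⟩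
    · by_contra hij
      obtain ⟨ε, hε, h⟩ : ∃ ε : ℝ, 0 < ε ∧
          ε ≤ min (min (q i) (u i - q i)) (min (q j) (u j - q j)) :=
        ⟨_, by simp [hi, hj], le_rfl⟩
      simp only [le_min_iff] at h
      obtain ⟨⟨h1, h2⟩, h3, h4⟩ := h
      have hd := eq_zero_of_mem_extremePoints_of_add_mem_of_sub_mem
        (d := Pi.single i ε - Pi.single j ε) hext
        ⟨fun k => ?_, by simpa [Finset.sum_add_distrib] using hqs⟩
        ⟨fun k => ?_, by simpa using hqs⟩
      · have := congrFun hd i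
        simp [hij] at this
        exact hε.ne' this
      all_goals
        have := hqb k
        simp only [Pi.add_apply, Pi.sub_apply, Pi.single_apply]
        split_ifs <;> subst_vars <;> constructor <;> linarith
    · by_contra hne
      have hlt := lt_of_le_of_ne hqs hne
      obtain ⟨ε, hε, h⟩ : ∃ ε : ℝ, 0 < ε ∧
          ε ≤ min (min (q i) (u i - q i)) (Q - ∑ i, q i) :=
        ⟨_, by simp [hi, hlt], le_rfl⟩
      simp only [le_min_iff] at h
      obtain ⟨⟨h1, h2⟩, h3⟩ := h
      have hd := eq_zero_of_mem_extremePoints_of_add_mem_of_sub_mem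
        (d := Pi.single i ε) hext
        ⟨fun k => ?_, by simp [Finset.sum_add_distrib]; linarith⟩
        ⟨fun k => ?_, by simp; linarith⟩
      · exact hε.ne' (by simpa using hd)
      all_goals
        have := hqb k
        simp only [Pi.add_apply, Pi.sub_apply, Pi.single_apply]
        split_ifs <;> subst_vars <;> constructor <;> linarith
  · rintro ⟨huniq, hsum⟩
    refine ⟨⟨hqb, hqs⟩, ?_⟩
    rintro x ⟨hxb, hxs⟩ y ⟨hyb, hys⟩ ⟨a, b, ha, hb, hab, hxy⟩
    have hco : ∀ k, a * x k + b * y k = q k := fun k => by simpa using congrFun hxy k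
    have hfix : ∀ k, ¬ (0 < q k ∧ q k < u k) → x k = q k := by
      intro k hk
      rcases (hqb k).1.eq_or_lt with h0 | h0
      · have := eq_of_convex_combination_eq_upper ha hb hab (neg_nonpos.2 (hxb k).1)
          (neg_nonpos.2 (hyb k).1) (by linarith [hco k])
        linarith
      · have hqu : q k = u k := le_antisymm (hqb k).2 (not_lt.1 fun h => hk ⟨h0, h⟩)
        rw [hqu]
        exact eq_of_convex_combination_eq_upper ha hb hab (hxb k).2 (hyb k).2
          ((hco k).trans hqu)
    by_cases hex : ∃ i, 0 < q i ∧ q i < u i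
    · have hQs := hsum hex
      obtain ⟨i, hi⟩ := hex
      have hoff : ∀ k, k ≠ i → x k = q k := fun k hk =>
        hfix k fun hp => hk (huniq k i hp hi)
      have hxQ : ∑ k, x k = Q := by
        refine eq_of_convex_combination_eq_upper ha hb hab hxs hys ?_
        rw [Finset.mul_sum, Finset.mul_sum, ← Finset.sum_add_distrib, ← hQs]
        exact Finset.sum_congr rfl fun k _ => hco k
      have hdiff : ∑ k, (x k - q k) = x i - q i :=
        Fintype.sum_eq_single i fun k hk => sub_eq_zero.2 (hoff k hk)
      rw [Finset.sum_sub_distrib] at hdiff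
      funext k
      by_cases hk : k = i
      · subst hk
        linarith
      · exact hoff k hk
    · exact funext fun k => hfix k fun hk => hex ⟨k, hk⟩
end

section
/- Let n ≥ 1, let u ∈ ℝⁿ with u_i ≥ 0 for all i, let Q ≥ 0, and let P = {q ∈ ℝⁿ : 0 ≤ q_i ≤ u_i for all i, and ∑_{i=1}^{n} q_i ≤ Q}. Then every point of P is a convex combination of points of P each of which has at most one partial coordinate; that is, P is contained in the convex hull of the set {q ∈ P : at most one index i satisfies 0 < q_i < u_i}. In words: every route delivery pattern can be generated as a convex combination of extreme route delivery patterns. -/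
/-- The coordinates of `x` lying strictly between `0` and the upper bound `u`. -/
noncomputable def partialCoords {ι : Type*} [Fintype ι] (u x : ι → ℝ) : Finset ι :=
  {i | 0 < x i ∧ x i < u i}

/-- Shifting quantity from one partial coordinate to another until one of them reaches a bound
stays in the box, keeps the total, and makes the set of partial coordinates strictly smaller. -/
theorem exists_shift_partialCoords_ssubset {ι : Type*} [Fintype ι] [DecidableEq ι]
    {u x : ι → ℝ} (hx : ∀ k, 0 ≤ x k ∧ x k ≤ u k) {i j : ι} (hij : i ≠ j)
    (hi : 0 < x i ∧ x i < u i) (hj : 0 < x j ∧ x j < u j) :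
    ∃ s : ℝ, 0 < s ∧ ∃ y : ι → ℝ, y = x + s • (Pi.single i 1 - Pi.single j 1) ∧
      (∀ k, 0 ≤ y k ∧ y k ≤ u k) ∧ ∑ k, y k = ∑ k, x k ∧
      partialCoords u y ⊂ partialCoords u x := by
  obtain ⟨s, hs, hsi, hsj, hend⟩ : ∃ s : ℝ, 0 < s ∧ s ≤ u i - x i ∧ s ≤ x j ∧
      (s = u i - x i ∨ s = x j) :=
    ⟨min (u i - x i) (x j), lt_min (sub_pos.2 hi.2) hj.1, min_le_left _ _, min_le_right _ _,
      min_choice _ _⟩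
  refine ⟨s, hs, _, rfl, ?_⟩
  set y : ι → ℝ := x + s • (Pi.single i 1 - Pi.single j 1) with hy
  have hyi : y i = x i + s := by simp [hy, hij]
  have hyj : y j = x j - s := by simp [hy, hij.symm, sub_eq_add_neg]
  have hyk : ∀ k, k ≠ i → k ≠ j → y k = x k := fun k hki hkj => by simp [hy, hki, hkj]
  refine ⟨fun k => ?_, ?_, ?_⟩
  · have := hx k
    by_cases hki : k = i
    · subst hki; constructor <;> linarith
    by_cases hkj : k = j
    · subst hkj; constructor <;> linarith
    rwa [hyk k hki hkj]
  · simp [hy, Finset.sum_add_distrib, ← Finset.mul_sum]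
  · rw [Finset.ssubset_iff_subset_ne]
    refine ⟨fun k hk => ?_, fun h => ?_⟩
    · by_cases hki : k = i
      · subst hki; simpa [partialCoords] using hi
      by_cases hkj : k = j
      · subst hkj; simpa [partialCoords] using hj
      simpa [partialCoords, hyk k hki hkj] using hk
    · have hi' : i ∈ partialCoords u y := by rw [h]; simpa [partialCoords] using hi
      have hj' : j ∈ partialCoords u y := by rw [h]; simpa [partialCoords] using hj
      simp only [partialCoords, Finset.mem_filter, Finset.mem_univ, true_and] at hi' hj'
      rcases hend with h | h <;> linarith [hi'.2, hj'.1]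


/-- Every point of the polytope `P = {q : 0 ≤ qᵢ ≤ uᵢ, ∑ᵢ qᵢ ≤ Q}` is a convex
combination of points of `P` having at most one partial coordinate, i.e. `P` is
contained in the convex hull of its points with at most one partial coordinate.
(Every RDP is a convex combination of extreme RDPs.) -/
theorem rdp_convexHull_of_extreme
    (n : ℕ) (hn : 1 ≤ n) (u : Fin n → ℝ) (hu : ∀ i, 0 ≤ u i) (Q : ℝ) (hQ : 0 ≤ Q) :
    {x : Fin n → ℝ | (∀ i, 0 ≤ x i ∧ x i ≤ u i) ∧ ∑ i, x i ≤ Q} ⊆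
      convexHull ℝ {x : Fin n → ℝ |
        ((∀ i, 0 ≤ x i ∧ x i ≤ u i) ∧ ∑ i, x i ≤ Q) ∧
          (∀ i j, (0 < x i ∧ x i < u i) → (0 < x j ∧ x j < u j) → i = j)} := by
  rintro x ⟨hx, hsum⟩
  induction hc : partialCoords u x using Finset.strongInduction generalizing x with
  | H S ih =>
    subst hc
    by_cases hext : ∀ i j, (0 < x i ∧ x i < u i) → (0 < x j ∧ x j < u j) → i = j
    · exact subset_convexHull ℝ _ ⟨⟨hx, hsum⟩, hext⟩
    push Not at hext
    obtain ⟨i, j, hi, hj, hij⟩ := hext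
    obtain ⟨s, hs, y, hy, hybox, hysum, hylt⟩ :=
      exists_shift_partialCoords_ssubset hx hij hi hj
    obtain ⟨t, ht, z, hz, hzbox, hzsum, hzlt⟩ :=
      exists_shift_partialCoords_ssubset hx hij.symm hj hi
    have hst : s + t ≠ 0 := (add_pos hs ht).ne'
    have hcomb : x = (t / (s + t)) • y + (s / (s + t)) • z := by
      ext k
      simp only [hy, hz, Pi.add_apply, Pi.smul_apply, Pi.sub_apply, smul_eq_mul]
      field_simp
      ring
    rw [hcomb]
    exact convex_convexHull ℝ _ (ih _ hylt hybox (hysum.trans_le hsum) rfl)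
      (ih _ hzlt hzbox (hzsum.trans_le hsum) rfl) (by positivity) (by positivity)
      (by field_simp; ring)
end
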